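/- arXiv:2311.03909 — 5 statements merged into one kernel-verified Lean document; each statement's English description precedes it below -/
import Mathlib

section
/- Let P = {x ∈ ℝⁿ : Ax ≤ b} with A ∈ ℤ^{m×n}, b ∈ ℤ^m, and b_j ≥ 1 for all j. Fix ε > 0 and set k(ε) = ⌈1 + 1/ε⌉. Define P̃ = {x ∈ P : λᵀA x ≤ ⌊λᵀb⌋ for all λ ∈ {0,1/2}^m with λᵀA ∈ ℤⁿ and λᵀ𝟙 ≤ k(ε)}. Then P_{1/2} ⊆ P̃, and for every x* ∈ P̃ the point (1/(1+ε)) x* belongs to P_{1/2}; that is, P_{1/2} ⊆ P̃ ⊆ (1+ε) P_{1/2}, where (1+ε)P_{1/2} = {(1+ε)x : x ∈ P_{1/2}}. -/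
open Pointwise

/-- Approximation of the {0,1/2}-closure: if `b ≥ 𝟙`, then with `k(ε) = ⌈1 + 1/ε⌉`,
the relaxation `P̃` using only cuts with `λᵀ𝟙 ≤ k(ε)` satisfies
`P_{1/2} ⊆ P̃ ⊆ (1+ε) P_{1/2}`. -/
theorem half_closure_approximation {m n : ℕ}
    (A : Matrix (Fin m) (Fin n) ℤ) (b : Fin m → ℤ)
    (hb : ∀ j, 1 ≤ b j) (ε : ℝ) (hε : 0 < ε) :
    let P : Set (Fin n → ℝ) := {x | ∀ j, ∑ i, (A j i : ℝ) * x i ≤ (b j : ℝ)}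
    let Phalf : Set (Fin n → ℝ) := {x ∈ P | ∀ l : Fin m → ℝ,
      (∀ j, l j = 0 ∨ l j = 1 / 2) →
      (∀ i, ∃ z : ℤ, ∑ j, l j * (A j i : ℝ) = (z : ℝ)) →
      ∑ i, (∑ j, l j * (A j i : ℝ)) * x i ≤ (⌊∑ j, l j * (b j : ℝ)⌋ : ℝ)}
    let Ptilde : Set (Fin n → ℝ) := {x ∈ P | ∀ l : Fin m → ℝ,
      (∀ j, l j = 0 ∨ l j = 1 / 2) →
      (∀ i, ∃ z : ℤ, ∑ j, l j * (A j i : ℝ) = (z : ℝ)) →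
      (∑ j, l j ≤ ((⌈1 + 1 / ε⌉ : ℤ) : ℝ)) →
      ∑ i, (∑ j, l j * (A j i : ℝ)) * x i ≤ (⌊∑ j, l j * (b j : ℝ)⌋ : ℝ)}
    Phalf ⊆ Ptilde ∧
    (∀ xs ∈ Ptilde, (fun i => (1 / (1 + ε)) * xs i) ∈ Phalf) ∧
    Ptilde ⊆ (1 + ε) • Phalf := by
  intro P Phalf Ptilde
  have h1 : (0:ℝ) < 1 + ε := by linarith
  have key : ∀ xs ∈ Ptilde, (fun i => (1 / (1 + ε)) * xs i) ∈ Phalf := by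
    rintro xs ⟨hP, hT⟩
    have hscale : ∀ c : Fin n → ℝ, ∑ i, c i * ((1 / (1 + ε)) * xs i)
        = (∑ i, c i * xs i) / (1 + ε) := by
      intro c
      rw [Finset.sum_div]
      refine Finset.sum_congr rfl fun i _ => ?_
      ring
    have hbR : ∀ j, (1:ℝ) ≤ b j := fun j => by exact_mod_cast hb j
    refine ⟨fun j => ?_, fun l hl hz => ?_⟩
    · rw [hscale (fun i => (A j i : ℝ)), div_le_iff₀ h1]
      have h2 : ∑ i, (A j i : ℝ) * xs i ≤ (b j : ℝ) := hP j
      nlinarith [hbR j]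
    · rw [hscale (fun i => ∑ j, l j * (A j i : ℝ)), div_le_iff₀ h1]
      have hl0 : ∀ j, 0 ≤ l j := fun j => by
        rcases hl j with h | h <;> rw [h] <;> norm_num
      have hsum : ∑ j, l j ≤ ∑ j, l j * (b j : ℝ) :=
        Finset.sum_le_sum fun j _ => by nlinarith [hl0 j, hbR j]
      have hs0 : 0 ≤ ∑ j, l j := Finset.sum_nonneg fun j _ => hl0 j
      by_cases hk : ∑ j, l j ≤ ((⌈1 + 1 / ε⌉ : ℤ) : ℝ)
      · have h3 := hT l hl hz hk
        have h4 : (0:ℝ) ≤ (⌊∑ j, l j * (b j : ℝ)⌋ : ℝ) := by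
          exact_mod_cast Int.floor_nonneg.mpr (hs0.trans hsum)
        nlinarith
      · push Not at hk
        have h5 : ∑ i, (∑ j, l j * (A j i : ℝ)) * xs i ≤ ∑ j, l j * (b j : ℝ) := by
          have h6 : ∑ i, (∑ j, l j * (A j i : ℝ)) * xs i
              = ∑ j, l j * ∑ i, (A j i : ℝ) * xs i := by
            simp only [Finset.sum_mul, Finset.mul_sum]
            rw [Finset.sum_comm]
            simp only [mul_assoc]
          rw [h6]
          exact Finset.sum_le_sum fun j _ => mul_le_mul_of_nonneg_left (hP j) (hl0 j)
        have h7 := Int.le_ceil (1 + 1 / ε)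
        have h8 := Int.lt_floor_add_one (∑ j, l j * (b j : ℝ))
        have h9 : 1 + 1 / ε ≤ ∑ j, l j * (b j : ℝ) := by linarith
        have h10 : ε * (1 + 1 / ε) = ε + 1 := by field_simp
        have h11 := mul_le_mul_of_nonneg_left h9 hε.le
        nlinarith
  refine ⟨fun x hx => ⟨hx.1, fun l hl hz _ => hx.2 l hl hz⟩, key, fun x hx => ?_⟩
  refine ⟨_, key x hx, ?_⟩
  funext i
  simp only [Pi.smul_apply, smul_eq_mul]
  field_simp
end

section
/- Let P = {x ∈ ℝⁿ : Ax ≤ b} be a bounded polyhedron (polytope) with A ∈ ℤ^{m×n}, b ∈ ℤ^m, and b_j ≥ 1 for all j. Fix ε > 0, set k(ε) = ⌈1 + 1/ε⌉, and define P̃ = {x ∈ P : λᵀA x ≤ ⌊λᵀb⌋ for all λ ∈ {0,1/2}^m with λᵀA ∈ ℤⁿ and λᵀ𝟙 ≤ k(ε)}. Then for every c ∈ ℝⁿ: max{cᵀx : x ∈ P_{1/2}} ≤ max{cᵀx : x ∈ P̃} ≤ (1+ε) · max{cᵀx : x ∈ P_{1/2}}. -/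
/-- PTAS guarantee: for a polytope `P = {x : Ax ≤ b}` with `b ≥ 𝟙`, bounded, and
`k(ε) = ⌈1 + 1/ε⌉`, the relaxation `P̃` using only cuts with `λᵀ𝟙 ≤ k(ε)` satisfies
`max{cᵀx : x ∈ P_{1/2}} ≤ max{cᵀx : x ∈ P̃} ≤ (1+ε) max{cᵀx : x ∈ P_{1/2}}`. -/
theorem half_closure_ptas {m n : ℕ}
    (A : Matrix (Fin m) (Fin n) ℤ) (b : Fin m → ℤ)
    (hb : ∀ j, 1 ≤ b j) (ε : ℝ) (hε : 0 < ε)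
    (hbdd : Bornology.IsBounded
      {x : Fin n → ℝ | ∀ j, ∑ i, (A j i : ℝ) * x i ≤ (b j : ℝ)})
    (c : Fin n → ℝ) :
    let P : Set (Fin n → ℝ) := {x | ∀ j, ∑ i, (A j i : ℝ) * x i ≤ (b j : ℝ)}
    let Phalf : Set (Fin n → ℝ) := {x ∈ P | ∀ l : Fin m → ℝ,
      (∀ j, l j = 0 ∨ l j = 1 / 2) →
      (∀ i, ∃ z : ℤ, ∑ j, l j * (A j i : ℝ) = (z : ℝ)) →
      ∑ i, (∑ j, l j * (A j i : ℝ)) * x i ≤ (⌊∑ j, l j * (b j : ℝ)⌋ : ℝ)}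
    let Ptilde : Set (Fin n → ℝ) := {x ∈ P | ∀ l : Fin m → ℝ,
      (∀ j, l j = 0 ∨ l j = 1 / 2) →
      (∀ i, ∃ z : ℤ, ∑ j, l j * (A j i : ℝ) = (z : ℝ)) →
      (∑ j, l j ≤ ((⌈1 + 1 / ε⌉ : ℤ) : ℝ)) →
      ∑ i, (∑ j, l j * (A j i : ℝ)) * x i ≤ (⌊∑ j, l j * (b j : ℝ)⌋ : ℝ)}
    sSup ((fun x : Fin n → ℝ => ∑ i, c i * x i) '' Phalf)
        ≤ sSup ((fun x : Fin n → ℝ => ∑ i, c i * x i) '' Ptilde) ∧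
    sSup ((fun x : Fin n → ℝ => ∑ i, c i * x i) '' Ptilde)
        ≤ (1 + ε) * sSup ((fun x : Fin n → ℝ => ∑ i, c i * x i) '' Phalf) := by
  intro P Phalf Ptilde
  have hs : (0:ℝ) < 1 + ε := by linarith
  have hbR : ∀ j, (1:ℝ) ≤ (b j : ℝ) := fun j => by exact_mod_cast hb j
  have hbd : ∀ S : Set (Fin n → ℝ), S ⊆ P →
      BddAbove ((fun x : Fin n → ℝ => ∑ i, c i * x i) '' S) := by
    intro S hS
    obtain ⟨R, hR⟩ := hbdd.exists_norm_le
    refine ⟨∑ i, |c i| * R, ?_⟩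
    rintro _ ⟨x, hx, rfl⟩
    refine Finset.sum_le_sum fun i _ => ?_
    have h1 : |x i| ≤ R := (norm_le_pi_norm x i).trans (hR x (hS hx))
    calc c i * x i ≤ |c i * x i| := le_abs_self _
      _ = |c i| * |x i| := abs_mul _ _
      _ ≤ |c i| * R := mul_le_mul_of_nonneg_left h1 (abs_nonneg _)
  have hsub : Phalf ⊆ Ptilde := fun x hx => ⟨hx.1, fun l h1 h2 _ => hx.2 l h1 h2⟩
  have hl0 : ∀ l : Fin m → ℝ, (∀ j, l j = 0 ∨ l j = 1 / 2) → ∀ j, 0 ≤ l j := by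
    intro l hl j
    rcases hl j with h | h <;> rw [h] <;> norm_num
  have hfl : ∀ l : Fin m → ℝ, (∀ j, l j = 0 ∨ l j = 1 / 2) →
      (0:ℝ) ≤ (⌊∑ j, l j * (b j : ℝ)⌋ : ℝ) := by
    intro l hl
    have : (0:ℤ) ≤ ⌊∑ j, l j * (b j : ℝ)⌋ := Int.floor_nonneg.2
      (Finset.sum_nonneg fun j _ => mul_nonneg (hl0 l hl j) (by linarith [hbR j]))
    exact_mod_cast this
  have h0 : (0 : Fin n → ℝ) ∈ Phalf := by
    refine ⟨fun j => ?_, fun l hl _ => ?_⟩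
    · simpa using le_trans zero_le_one (hbR j)
    · simpa using hfl l hl
  have hscale : ∀ (a x : Fin n → ℝ), ∑ i, a i * (((1 + ε)⁻¹ • x) i)
      = (∑ i, a i * x i) / (1 + ε) := by
    intro a x
    rw [Finset.sum_div]
    refine Finset.sum_congr rfl fun i _ => ?_
    simp only [Pi.smul_apply, smul_eq_mul]
    ring
  have hdiv : ∀ t r : ℝ, 0 ≤ r → t ≤ r → t / (1 + ε) ≤ r := by
    intro t r hr ht
    rw [div_le_iff₀ hs]
    nlinarith
  have key : ∀ x ∈ Ptilde, (1 + ε)⁻¹ • x ∈ Phalf := by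
    rintro x ⟨hxP, hx⟩
    refine ⟨fun j => ?_, fun l hl hz => ?_⟩
    · rw [hscale (fun i => (A j i : ℝ)) x]
      exact hdiv _ _ (by linarith [hbR j]) (hxP j)
    · rw [hscale (fun i => ∑ j, l j * (A j i : ℝ)) x]
      by_cases hk : ∑ j, l j ≤ ((⌈1 + 1 / ε⌉ : ℤ) : ℝ)
      · exact hdiv _ _ (hfl l hl) (hx l hl hz hk)
      · push Not at hk
        have h1 : 1 + 1 / ε ≤ ((⌈1 + 1 / ε⌉ : ℤ) : ℝ) := Int.le_ceil _
        have h2 : ∑ j, l j ≤ ∑ j, l j * (b j : ℝ) :=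
          Finset.sum_le_sum fun j _ => le_mul_of_one_le_right (hl0 l hl j) (hbR j)
        have h3 : ∑ i, (∑ j, l j * (A j i : ℝ)) * x i ≤ ∑ j, l j * (b j : ℝ) := by
          have : ∑ i, (∑ j, l j * (A j i : ℝ)) * x i
              = ∑ j, l j * ∑ i, (A j i : ℝ) * x i := by
            simp only [Finset.sum_mul, Finset.mul_sum]
            rw [Finset.sum_comm]
            simp only [mul_assoc]
          rw [this]
          exact Finset.sum_le_sum fun j _ => mul_le_mul_of_nonneg_left (hxP j) (hl0 l hl j)
        have h4 := Int.sub_one_lt_floor (∑ j, l j * (b j : ℝ))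
        refine le_trans ?_ h4.le
        rw [div_le_iff₀ hs]
        have h5 : 1 + 1 / ε ≤ ∑ j, l j * (b j : ℝ) := by linarith
        have h6 : (1 + 1 / ε) * ε ≤ (∑ j, l j * (b j : ℝ)) * ε :=
          mul_le_mul_of_nonneg_right h5 hε.le
        have h7 : (1 + 1 / ε) * ε = ε + 1 := by field_simp
        linarith
  refine ⟨csSup_le_csSup (hbd _ fun x hx => hx.1) ⟨_, 0, h0, rfl⟩ (Set.image_mono hsub), ?_⟩
  refine csSup_le ⟨_, 0, hsub h0, rfl⟩ ?_
  rintro _ ⟨x, hx, rfl⟩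
  have h := le_csSup (hbd Phalf fun x hx => hx.1) ⟨_, key x hx, rfl⟩
  have h' := hscale c x
  simp only at h
  rw [h', div_le_iff₀ hs] at h
  linarith
end

section
/- Let P = {x ∈ ℝⁿ : Ax ≤ b} with A ∈ ℤ^{m×n}, b ∈ ℤ^m, and b_j ≥ 1 for all j. Fix an integer k ≥ 2 and ε > 0, and set k(ε) = ⌈1 + 1/ε⌉. Define P̃ = {x ∈ P : λᵀA x ≤ ⌊λᵀb⌋ for all λ ∈ {0, 1/k, …, (k−1)/k}^m with λᵀA ∈ ℤⁿ and λᵀ𝟙 ≤ k(ε)}. Then P_{mod k} ⊆ P̃ and P̃ ⊆ (1+ε) P_{mod k}; i.e., for every x* ∈ P̃ the point (1/(1+ε)) x* belongs to P_{mod k}. -/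
open Pointwise

/-- Approximation of the (mod k)-closure: if `b ≥ 𝟙`, then with `k(ε) = ⌈1 + 1/ε⌉`,
the relaxation `P̃` using only (mod k)-cuts with `λᵀ𝟙 ≤ k(ε)` satisfies
`P_{mod k} ⊆ P̃ ⊆ (1+ε) P_{mod k}`. -/
theorem mod_k_closure_approximation {m n : ℕ}
    (A : Matrix (Fin m) (Fin n) ℤ) (b : Fin m → ℤ)
    (hb : ∀ j, 1 ≤ b j) (k : ℕ) (hk : 2 ≤ k) (ε : ℝ) (hε : 0 < ε) :
    let P : Set (Fin n → ℝ) := {x | ∀ j, ∑ i, (A j i : ℝ) * x i ≤ (b j : ℝ)}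
    let Pmodk : Set (Fin n → ℝ) := {x ∈ P | ∀ l : Fin m → ℝ,
      (∀ j, ∃ t : ℕ, t < k ∧ l j = (t : ℝ) / (k : ℝ)) →
      (∀ i, ∃ z : ℤ, ∑ j, l j * (A j i : ℝ) = (z : ℝ)) →
      ∑ i, (∑ j, l j * (A j i : ℝ)) * x i ≤ (⌊∑ j, l j * (b j : ℝ)⌋ : ℝ)}
    let Ptilde : Set (Fin n → ℝ) := {x ∈ P | ∀ l : Fin m → ℝ,
      (∀ j, ∃ t : ℕ, t < k ∧ l j = (t : ℝ) / (k : ℝ)) →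
      (∀ i, ∃ z : ℤ, ∑ j, l j * (A j i : ℝ) = (z : ℝ)) →
      (∑ j, l j ≤ ((⌈1 + 1 / ε⌉ : ℤ) : ℝ)) →
      ∑ i, (∑ j, l j * (A j i : ℝ)) * x i ≤ (⌊∑ j, l j * (b j : ℝ)⌋ : ℝ)}
    Pmodk ⊆ Ptilde ∧
    (∀ xs ∈ Ptilde, (fun i => (1 / (1 + ε)) * xs i) ∈ Pmodk) ∧
    Ptilde ⊆ (1 + ε) • Pmodk := by
  intro P Pmodk Ptilde
  have h1 : (0 : ℝ) < 1 + ε := by linarith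
  have key : ∀ xs ∈ Ptilde, (fun i => (1 / (1 + ε)) * xs i) ∈ Pmodk := by
    rintro x ⟨hxP, hx⟩
    have hP : ∀ j, ∑ i, (A j i : ℝ) * x i ≤ (b j : ℝ) := hxP
    have hbR : ∀ j, (1 : ℝ) ≤ (b j : ℝ) := fun j => by exact_mod_cast hb j
    have scale : ∀ c : Fin n → ℝ, ∑ i, c i * ((1 / (1 + ε)) * x i)
        = (∑ i, c i * x i) / (1 + ε) := by
      intro c
      rw [Finset.sum_div]
      refine Finset.sum_congr rfl fun i _ => ?_
      ring
    refine ⟨?_, ?_⟩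
    · show ∀ j, ∑ i, (A j i : ℝ) * ((1 / (1 + ε)) * x i) ≤ (b j : ℝ)
      intro j
      rw [scale (fun i => (A j i : ℝ)), div_le_iff₀ h1]
      nlinarith [hP j, hbR j]
    · intro l hl hz
      show ∑ i, (∑ j, l j * (A j i : ℝ)) * ((1 / (1 + ε)) * x i) ≤ _
      rw [scale (fun i => ∑ j, l j * (A j i : ℝ)), div_le_iff₀ h1]
      have hl0 : ∀ j, 0 ≤ l j := by
        intro j
        obtain ⟨t, _, ht⟩ := hl j
        rw [ht]
        positivity
      have hsum : ∑ j, l j ≤ ∑ j, l j * (b j : ℝ) :=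
        Finset.sum_le_sum fun j _ => by nlinarith [hl0 j, hbR j]
      have hs0 : 0 ≤ ∑ j, l j := Finset.sum_nonneg fun j _ => hl0 j
      by_cases hc : ∑ j, l j ≤ ((⌈1 + 1 / ε⌉ : ℤ) : ℝ)
      · have h := hx l hl hz hc
        have hF : (0 : ℝ) ≤ (⌊∑ j, l j * (b j : ℝ)⌋ : ℝ) := by
          exact_mod_cast Int.floor_nonneg.mpr (hs0.trans hsum)
        nlinarith
      · have hK : 1 + 1 / ε ≤ ∑ j, l j * (b j : ℝ) := by
          have := Int.le_ceil (1 + 1 / ε)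
          linarith [not_le.mp hc]
        have hv : ∑ i, (∑ j, l j * (A j i : ℝ)) * x i ≤ ∑ j, l j * (b j : ℝ) := by
          have : ∑ i, (∑ j, l j * (A j i : ℝ)) * x i
              = ∑ j, l j * ∑ i, (A j i : ℝ) * x i := by
            simp_rw [Finset.sum_mul, Finset.mul_sum]
            rw [Finset.sum_comm]
            simp_rw [mul_assoc]
          rw [this]
          exact Finset.sum_le_sum fun j _ => mul_le_mul_of_nonneg_left (hP j) (hl0 j)
        have hF := Int.sub_one_lt_floor (∑ j, l j * (b j : ℝ))
        have hK2 : ε + 1 ≤ (∑ j, l j * (b j : ℝ)) * ε := by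
          have h := mul_le_mul_of_nonneg_right hK hε.le
          have e : (1 + 1 / ε) * ε = ε + 1 := by field_simp
          linarith
        have h3 := mul_le_mul_of_nonneg_right hF.le h1.le
        linarith
  refine ⟨fun x hx => ⟨hx.1, fun l hl hz _ => hx.2 l hl hz⟩, key, ?_⟩
  intro x hx
  refine ⟨_, key x hx, ?_⟩
  funext i
  simp only [Pi.smul_apply, smul_eq_mul]
  field_simp
end

section
/- Let G = (V, E) be a finite simple graph with nonnegative edge lengths ℓ : E → ℝ≥0, and let e = {v, w} ∈ E be an edge such that v and w are connected in the graph G − e obtained by deleting e. Then the minimum of Σ_{f ∈ F} ℓ(f), taken over all edge subsets F ⊆ E with e ∈ F such that every vertex of V has even degree in the subgraph (V, F), equals ℓ(e) plus the shortest-path distance (with respect to ℓ) from v to w in G − e. -/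
/-- An even edge set containing `s(v,w)` still connects `v` to `w` after removing that edge. -/
theorem even_erase_reachable {V : Type*} [Fintype V] [DecidableEq V] (v w : V)
    (F : Finset (Sym2 V)) (hdiag : ∀ f ∈ F, ¬ f.IsDiag) (he : s(v, w) ∈ F)
    (hev : ∀ u : V, Even ((F.filter (fun f => u ∈ f)).card)) :
    (SimpleGraph.fromEdgeSet (↑(F.erase s(v, w)) : Set (Sym2 V))).Reachable v w := by
  classical
  by_contra hr
  set H := SimpleGraph.fromEdgeSet (↑(F.erase s(v, w)) : Set (Sym2 V)) with hH
  let S : Finset V := Finset.univ.filter (fun u => H.Reachable v u)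
  have hsum : ∑ u ∈ S, (F.filter (fun f => u ∈ f)).card
      = ∑ f ∈ F, (S.filter (fun u => u ∈ f)).card := by
    simp only [Finset.card_filter]
    exact Finset.sum_comm
  have h1 : Even (∑ u ∈ S, (F.filter (fun f => u ∈ f)).card) :=
    Finset.even_sum _ (fun u _ => hev u)
  rw [hsum, ← Finset.add_sum_erase _ _ he] at h1
  have h2 : Even (∑ f ∈ F.erase s(v, w), (S.filter (fun u => u ∈ f)).card) := by
    refine Finset.even_sum _ (fun f hf => ?_)
    induction f using Sym2.ind with
    | _ a b =>
      have hab : a ≠ b := by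
        have := hdiag _ (Finset.mem_of_mem_erase hf)
        simpa using this
      have hadj : H.Adj a b := by
        rw [hH, SimpleGraph.fromEdgeSet_adj]
        exact ⟨hf, hab⟩
      by_cases ha : H.Reachable v a
      · have hb : H.Reachable v b := ha.trans hadj.reachable
        have : S.filter (fun u => u ∈ s(a, b)) = {a, b} := by
          ext u
          simp only [S, Finset.mem_filter, Finset.mem_univ, true_and, Sym2.mem_iff,
            Finset.mem_insert, Finset.mem_singleton]
          constructor
          · exact fun h => h.2
          · rintro (rfl | rfl)
            · exact ⟨ha, Or.inl rfl⟩
            · exact ⟨hb, Or.inr rfl⟩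
        rw [this, Finset.card_pair hab]
        exact even_two
      · have hb : ¬ H.Reachable v b := fun h => ha (h.trans hadj.symm.reachable)
        have : S.filter (fun u => u ∈ s(a, b)) = ∅ := by
          ext u
          simp only [S, Finset.mem_filter, Finset.mem_univ, true_and, Sym2.mem_iff,
            Finset.notMem_empty, iff_false]
          rintro ⟨h, rfl | rfl⟩
          · exact ha h
          · exact hb h
        rw [this]
        simp
  have h3 : S.filter (fun u => u ∈ s(v, w)) = {v} := by
    ext u
    simp only [S, Finset.mem_filter, Finset.mem_univ, true_and, Sym2.mem_iff,
      Finset.mem_singleton]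
    constructor
    · rintro ⟨h, rfl | rfl⟩
      · rfl
      · exact absurd h hr
    · rintro rfl
      exact ⟨SimpleGraph.Reachable.refl _, Or.inl rfl⟩
  rw [h3, Finset.card_singleton, Nat.even_add] at h1
  exact absurd (h1.2 h2) (by decide)

/-- In a finite simple graph with nonnegative edge lengths, the minimum total length of
an edge set `F` containing a prescribed edge `e = {v,w}` in which every vertex has even
degree equals `ℓ(e)` plus the shortest-path distance from `v` to `w` in `G − e`. -/
theorem min_even_subgraph_through_edge {V : Type*} [Fintype V] [DecidableEq V]
    (G : SimpleGraph V) [DecidableRel G.Adj]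
    (ℓ : Sym2 V → ℝ) (hℓ : ∀ f, 0 ≤ ℓ f)
    (v w : V) (he : s(v, w) ∈ G.edgeSet)
    (hconn : (G.deleteEdges {s(v, w)}).Reachable v w) :
    sInf {r : ℝ | ∃ F : Finset (Sym2 V), ↑F ⊆ G.edgeSet ∧ s(v, w) ∈ F ∧
        (∀ u : V, Even ((F.filter (fun f => u ∈ f)).card)) ∧
        r = ∑ f ∈ F, ℓ f}
      = ℓ s(v, w) +
        sInf {r : ℝ | ∃ p : (G.deleteEdges {s(v, w)}).Walk v w, p.IsPath ∧
          r = (p.edges.map ℓ).sum} := by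
  -- every path yields an even edge set
  have key1 : ∀ p : (G.deleteEdges {s(v, w)}).Walk v w, p.IsPath →
      ∃ F : Finset (Sym2 V), ↑F ⊆ G.edgeSet ∧ s(v, w) ∈ F ∧
        (∀ u : V, Even ((F.filter (fun f => u ∈ f)).card)) ∧
        ℓ s(v, w) + (p.edges.map ℓ).sum = ∑ f ∈ F, ℓ f := by
    intro p hp
    have hadj : G.Adj w v := (show G.Adj v w from he).symm
    have hle : G.deleteEdges {s(v, w)} ≤ G := SimpleGraph.deleteEdges_le _
    let q : G.Walk w w := SimpleGraph.Walk.cons hadj (p.mapLe hle)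
    have hqe : q.edges = s(v, w) :: p.edges := by
      simp [q, Sym2.eq_swap]
    have hnot : s(v, w) ∉ p.edges := by
      intro h
      have := p.edges_subset_edgeSet h
      simp at this
    have hnd : q.edges.Nodup := by
      rw [hqe, List.nodup_cons]
      exact ⟨hnot, hp.isTrail.edges_nodup⟩
    have hqt : q.IsTrail := ⟨hnd⟩
    refine ⟨q.edges.toFinset, ?_, ?_, ?_, ?_⟩
    · intro f hf
      exact q.edges_subset_edgeSet (by simpa using hf)
    · rw [hqe]; simp
    · intro u
      have h := (hqt.even_countP_edges_iff u).2 (fun h => absurd rfl h)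
      have heq : q.edges.toFinset.filter (fun f => u ∈ f)
          = (q.edges.filter (fun f => decide (u ∈ f))).toFinset := by
        ext f
        simp
      rw [heq, List.toFinset_card_of_nodup (hnd.filter _), ← List.countP_eq_length_filter]
      exact h
    · rw [List.sum_toFinset _ hnd, hqe]
      simp
  -- every even edge set dominates a path
  have key2 : ∀ F : Finset (Sym2 V), ↑F ⊆ G.edgeSet → s(v, w) ∈ F →
      (∀ u : V, Even ((F.filter (fun f => u ∈ f)).card)) →
      ∃ p : (G.deleteEdges {s(v, w)}).Walk v w, p.IsPath ∧
        ℓ s(v, w) + (p.edges.map ℓ).sum ≤ ∑ f ∈ F, ℓ f := by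
    intro F hF heF hev
    obtain ⟨p, hp⟩ := (even_erase_reachable v w F
      (fun f hf => G.not_isDiag_of_mem_edgeSet (hF hf)) heF hev).exists_isPath
    have hle : SimpleGraph.fromEdgeSet (↑(F.erase s(v, w)) : Set (Sym2 V))
        ≤ G.deleteEdges {s(v, w)} := by
      intro a b hab
      rw [SimpleGraph.fromEdgeSet_adj] at hab
      have h := Finset.mem_erase.1 (Finset.mem_coe.1 hab.1)
      rw [SimpleGraph.deleteEdges_adj]
      exact ⟨hF h.2, h.1⟩
    refine ⟨p.mapLe hle, hp.mapLe hle, ?_⟩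
    have hed : (p.mapLe hle).edges = p.edges := by simp
    rw [hed, ← Finset.add_sum_erase _ _ heF, ← List.sum_toFinset _ hp.isTrail.edges_nodup]
    gcongr
    · exact fun i _ _ => hℓ i
    · intro f hf
      have h := p.edges_subset_edgeSet (List.mem_toFinset.1 hf)
      rw [SimpleGraph.edgeSet_fromEdgeSet] at h
      exact h.1
  obtain ⟨p0, hp0⟩ := hconn.exists_isPath
  obtain ⟨F0, hF1, hF2, hF3, hF4⟩ := key1 p0 hp0
  apply le_antisymm
  · rw [← sub_le_iff_le_add']
    refine le_csInf ⟨_, p0, hp0, rfl⟩ ?_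
    rintro r ⟨p, hp, rfl⟩
    rw [sub_le_iff_le_add']
    refine csInf_le ⟨0, ?_⟩ ?_
    · rintro r ⟨F, -, -, -, rfl⟩
      exact Finset.sum_nonneg (fun f _ => hℓ f)
    · exact key1 p hp
  · refine le_csInf ⟨_, F0, hF1, hF2, hF3, rfl⟩ ?_
    rintro r ⟨F, h1, h2, h3, rfl⟩
    obtain ⟨p, hp, hle⟩ := key2 F h1 h2 h3
    refine le_trans ?_ hle
    gcongr
    refine csInf_le ⟨0, ?_⟩ ⟨p, hp, rfl⟩
    rintro r ⟨p, -, rfl⟩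
    refine List.sum_nonneg ?_
    intro x hx
    obtain ⟨f, -, rfl⟩ := List.mem_map.1 hx
    exact hℓ f
end

section
/- Let A ∈ ℤ^{m×n}, b ∈ ℤ^m, let x̂ ∈ ℤⁿ satisfy A x̂ ≤ b, and let x* ∈ ℝⁿ. There exists a non-trivial {0,1/2}-cut of the system Ax ≤ b that is tight at x̂ and violated by x* if and only if there exists λ ∈ {0,1/2}^m with λᵀA ∈ ℤⁿ such that λᵀ(b − A x̂) = 1/2 and λᵀ(b − A x*) < 1/2. -/
/-- Primal separation characterization: there is a non-trivial {0,1/2}-cut tight at `x̂`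
and violated by `x*` iff there is `λ ∈ {0,1/2}^m` with `λᵀA` integral,
`λᵀ(b − A x̂) = 1/2`, and `λᵀ(b − A x*) < 1/2`. -/
theorem primal_separation_characterization {m n : ℕ}
    (A : Matrix (Fin m) (Fin n) ℤ) (b : Fin m → ℤ)
    (xhat : Fin n → ℤ) (hfeas : ∀ j, ∑ i, A j i * xhat i ≤ b j)
    (xs : Fin n → ℝ) :
    (∃ l : Fin m → ℝ, (∀ j, l j = 0 ∨ l j = 1 / 2) ∧
      (∀ i, ∃ z : ℤ, ∑ j, l j * (A j i : ℝ) = (z : ℝ)) ∧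
      (¬ ∃ z : ℤ, ∑ j, l j * (b j : ℝ) = (z : ℝ)) ∧
      (∑ i, (∑ j, l j * (A j i : ℝ)) * (xhat i : ℝ) = (⌊∑ j, l j * (b j : ℝ)⌋ : ℝ)) ∧
      ((⌊∑ j, l j * (b j : ℝ)⌋ : ℝ) < ∑ i, (∑ j, l j * (A j i : ℝ)) * xs i)) ↔
    (∃ l : Fin m → ℝ, (∀ j, l j = 0 ∨ l j = 1 / 2) ∧
      (∀ i, ∃ z : ℤ, ∑ j, l j * (A j i : ℝ) = (z : ℝ)) ∧
      ∑ j, l j * ((b j : ℝ) - ∑ i, (A j i : ℝ) * (xhat i : ℝ)) = 1 / 2 ∧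
      ∑ j, l j * ((b j : ℝ) - ∑ i, (A j i : ℝ) * xs i) < 1 / 2) := by
  have key : ∀ (l : Fin m → ℝ) (x : Fin n → ℝ),
      ∑ j, l j * ((b j : ℝ) - ∑ i, (A j i : ℝ) * x i) =
        ∑ j, l j * (b j : ℝ) - ∑ i, (∑ j, l j * (A j i : ℝ)) * x i := by
    intro l x
    simp only [mul_sub, Finset.sum_sub_distrib, Finset.mul_sum, Finset.sum_mul]
    rw [Finset.sum_comm]
    simp only [mul_assoc]
  refine exists_congr fun l => and_congr_right fun hl => and_congr_right fun hA => ?_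
  rw [key l (fun i => (xhat i : ℝ)), key l xs]
  have hk : ∃ k : ℤ, 2 * ∑ j, l j * (b j : ℝ) = (k : ℝ) := by
    have h1 : ∀ j, ∃ k : ℤ, 2 * (l j * (b j : ℝ)) = (k : ℝ) := by
      intro j
      rcases hl j with h | h
      · exact ⟨0, by simp [h]⟩
      · exact ⟨b j, by rw [h]; ring⟩
    choose k hk using h1
    exact ⟨∑ j, k j, by rw [Finset.mul_sum]; push_cast; exact Finset.sum_congr rfl fun j _ => hk j⟩
  have hz : ∃ z : ℤ, ∑ i, (∑ j, l j * (A j i : ℝ)) * (xhat i : ℝ) = (z : ℝ) := by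
    choose z hz using hA
    exact ⟨∑ i, z i * xhat i, by push_cast; exact Finset.sum_congr rfl fun i _ => by rw [hz i]⟩
  obtain ⟨k, hk⟩ := hk
  obtain ⟨z, hz⟩ := hz
  rw [hz]
  generalize ∑ j, l j * (b j : ℝ) = β at *
  generalize ∑ i, (∑ j, l j * (A j i : ℝ)) * xs i = γ at *
  constructor
  · rintro ⟨hn, ht, hv⟩
    have hβ : β - z = 1 / 2 := by
      rcases Int.even_or_odd' k with ⟨c, hc | hc⟩
      · exact absurd ⟨c, by rw [hc] at hk; push_cast at hk; linarith⟩ hn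
      · rw [hc] at hk
        push_cast at hk
        have hf : ⌊β⌋ = c := by
          rw [Int.floor_eq_iff]
          constructor <;> linarith
        rw [ht, hf]
        linarith
    exact ⟨hβ, by linarith⟩
  · rintro ⟨ht, hv⟩
    have hf : ⌊β⌋ = z := by
      rw [Int.floor_eq_iff]
      constructor <;> linarith
    rw [hf]
    refine ⟨?_, rfl, by linarith⟩
    rintro ⟨w, hw⟩
    have h2 : (2 * w - 2 * z : ℝ) = 1 := by linarith
    have h3 : 2 * w - 2 * z = 1 := by exact_mod_cast h2
    omega
end
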